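/- Let X be a noetherian scheme, F a coherent sheaf on X with a locally free presentation E₁ →^ρ E₀ → F → 0 where rank E₀ = l. For j ≥ 1 let Z_j ⊂ X be the closed subscheme cut out by the ideal sheaf generated by the (j)-th exterior power of ρ (i.e. the image of Hom(∧^j E₁, ∧^j E₀)^∨ → O_X). Then Z_j ⊂ Z_{j+1}, and the locally closed subscheme Z_{j+1} \ Z_j equals, as a scheme, the flattening stratum X_{l−j} of F (the stratum where F is locally free of rank l−j). -/

import Mathlib

/-!
STATEMENT 16: Let `X` be a noetherian scheme, `F` coherent with locally free
presentation `E₁ →^ρ E₀ → F → 0`, `rank E₀ = l`.  For `j ≥ 1` let `Z_j ⊂ X` be the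
closed subscheme cut out by the ideal of `j × j` minors of `ρ`.  Then `Z_j ⊂ Z_{j+1}`
and the locally closed subscheme `Z_{j+1} ∖ Z_j` equals, as a scheme, the flattening
stratum `X_{l−j}` of `F` (the stratum where `F` is locally free of rank `l−j`).

Affine formalization: `X = Spec A` (`A` noetherian), `ρ` an `l × s` matrix over `A`
presenting `M = coker ρ`.  `Z_j ⊂ Z_{j+1}` becomes the ideal inclusion
`I_{j+1} ⊆ I_j` of minor ideals.  The scheme equality `Z_{j+1} ∖ Z_j = X_{l−j}` is
expressed through the characterizing universal properties (Mumford): an affine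
noetherian `Y = Spec B → X` factors through `Z_{j+1} ∖ Z_j` (i.e. `φ(I_{j+1}) = 0`
and `φ(I_j)` generates the unit ideal) if and only if the pullback `B ⊗ M` is locally
free of rank `l − j` (finite projective with all fibers of dimension `l − j`).
-/

open TensorProduct

/-- The ideal generated by the `j × j` minors of the matrix `ρ`. -/
noncomputable def minorsIdeal (A : Type) [CommRing A] (l s : ℕ)
    (ρ : Matrix (Fin l) (Fin s) A) (j : ℕ) : Ideal A :=
  Ideal.span { x : A | ∃ (f : Fin j → Fin l) (g : Fin j → Fin s),
    x = Matrix.det (Matrix.of fun a b => ρ (f a) (g b)) }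

section helpers

variable {B : Type} [CommRing B] {l s : ℕ}

lemma minor_mem (N : Matrix (Fin l) (Fin s) B) {k : ℕ} (f : Fin k → Fin l) (g : Fin k → Fin s) :
    (N.submatrix f g).det ∈ minorsIdeal B l s N k :=
  Ideal.subset_span ⟨f, g, rfl⟩

lemma minorsIdeal_le_iff (N : Matrix (Fin l) (Fin s) B) {k : ℕ} (I : Ideal B) :
    minorsIdeal B l s N k ≤ I ↔ ∀ (f : Fin k → Fin l) (g : Fin k → Fin s),
      (N.submatrix f g).det ∈ I := by
  constructor
  · intro h f g
    exact h (minor_mem N f g)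
  · intro h
    refine Ideal.span_le.2 ?_
    rintro x ⟨f, g, rfl⟩
    exact h f g

lemma minorsIdeal_succ_le (N : Matrix (Fin l) (Fin s) B) (k : ℕ) :
    minorsIdeal B l s N (k + 1) ≤ minorsIdeal B l s N k := by
  rw [minorsIdeal_le_iff]
  intro f g
  rw [Matrix.det_succ_row_zero]
  refine Ideal.sum_mem _ fun i _ => Ideal.mul_mem_left _ _ ?_
  rw [Matrix.submatrix_submatrix]
  exact minor_mem N _ _

lemma minorsIdeal_map {A : Type} [CommRing A] (ρ : Matrix (Fin l) (Fin s) A) (φ : A →+* B)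
    (k : ℕ) : Ideal.map φ (minorsIdeal A l s ρ k) = minorsIdeal B l s (ρ.map φ) k := by
  apply le_antisymm
  · rw [Ideal.map_le_iff_le_comap, minorsIdeal_le_iff]
    intro f g
    rw [Ideal.mem_comap, RingHom.map_det]
    exact minor_mem (ρ.map φ) f g
  · rw [minorsIdeal_le_iff]
    intro f g
    have := Ideal.mem_map_of_mem φ (minor_mem ρ f g)
    rw [RingHom.map_det] at this
    exact this

lemma det_mul_rows {t k : ℕ} (P : Matrix (Fin k) (Fin t) B) (Q : Matrix (Fin t) (Fin k) B) :
    (P * Q).det = ∑ p : Fin k → Fin t, (∏ i, P i (p i)) * (Q.submatrix p id).det := by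
  have h1 : (P * Q) = fun i => ∑ a : Fin t, P i a • Q a := by
    ext i b
    simp [Matrix.mul_apply, Finset.sum_apply]
  have h2 := (Matrix.detRowAlternating (R := B) (n := Fin k)).toMultilinearMap.map_sum
    (fun i (a : Fin t) => P i a • Q a)
  have h3 : (P * Q).det = Matrix.detRowAlternating (R := B) (n := Fin k)
    (fun i => ∑ a : Fin t, P i a • Q a) := by rw [← h1]; rfl
  rw [h3]
  refine h2.trans (Finset.sum_congr rfl fun p _ => ?_)
  exact (Matrix.detRowAlternating (R := B) (n := Fin k)).toMultilinearMap.map_smul_univ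
    (fun i => P i (p i)) (fun i => Q (p i))

lemma minorsIdeal_mul {t : ℕ} (P : Matrix (Fin l) (Fin t) B) (Q : Matrix (Fin t) (Fin s) B)
    (k : ℕ) : minorsIdeal B l s (P * Q) k ≤ minorsIdeal B l t P k * minorsIdeal B t s Q k := by
  classical
  rw [minorsIdeal_le_iff]
  intro f g
  have h0 : (P * Q).submatrix f g = (P.submatrix f id) * (Q.submatrix id g) := by
    ext a b; simp [Matrix.mul_apply]
  rw [h0, det_mul_rows,
    ← Finset.sum_fiberwise (s := Finset.univ) (fun p : Fin k → Fin t => Finset.univ.image p)]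
  refine Ideal.sum_mem _ fun S _ => ?_
  by_cases hS : S.card = k
  · let e : Fin k ↪o Fin t := S.orderEmbOfFin hS
    have he : Finset.univ.image e = S := by simp [e]
    have key : ∑ p : Fin k → Fin t with Finset.univ.image p = S,
        (∏ i, P.submatrix f id i (p i)) * ((Q.submatrix id g).submatrix p id).det
        = (P.submatrix f e).det * (Q.submatrix e g).det := by
      rw [← Matrix.det_transpose (P.submatrix f e), Matrix.det_apply', Finset.sum_mul]
      symm
      refine Finset.sum_bij (fun (τ : Equiv.Perm (Fin k)) _ => fun i => e (τ i)) ?_ ?_ ?_ ?_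
      · intro τ _
        simp only [Finset.mem_filter, Finset.mem_univ, true_and]
        rw [← he]
        ext x
        simp only [Finset.mem_image, Finset.mem_univ, true_and]
        constructor
        · rintro ⟨a, rfl⟩; exact ⟨_, rfl⟩
        · rintro ⟨a, rfl⟩; exact ⟨τ.symm a, by simp⟩
      · intro τ _ τ' _ h
        ext i
        have := congrFun h i
        exact congrArg Fin.val (e.injective this)
      · intro p hp
        simp only [Finset.mem_filter, Finset.mem_univ, true_and] at hp
        have hinj : Function.Injective p := by
          rw [← Set.injOn_univ, ← Finset.coe_univ, ← Finset.card_image_iff, hp, hS]; simp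
        have hex : ∀ i, ∃ a, e a = p i := by
          intro i
          have : p i ∈ Finset.univ.image e := by
            rw [he, ← hp]; exact Finset.mem_image_of_mem _ (Finset.mem_univ i)
          simpa using this
        choose q hq using hex
        have hqi : Function.Injective q := by
          intro a b hab
          apply hinj
          rw [← hq, ← hq, hab]
        refine ⟨Equiv.ofBijective q (Finite.injective_iff_bijective.1 hqi), Finset.mem_univ _, ?_⟩
        funext i
        simp [hq]
      · intro τ _
        have h1 : ((Q.submatrix id g).submatrix (fun i => e (τ i)) id)
          = ((Q.submatrix e g).submatrix τ id) := rfl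
        rw [h1, Matrix.det_permute]
        simp only [Matrix.transpose_apply, Matrix.submatrix_apply, id]
        ring
    rw [key]
    exact Ideal.mul_mem_mul (minor_mem P _ _) (minor_mem Q _ _)
  · refine Ideal.sum_mem _ fun p hp => ?_
    simp only [Finset.mem_filter, Finset.mem_univ, true_and] at hp
    have hni : ¬ Function.Injective p := by
      intro hinj
      apply hS
      rw [← hp, Finset.card_image_of_injective _ hinj]; simp
    simp only [Function.Injective, not_forall] at hni
    obtain ⟨a, b, hab, hne⟩ := hni
    have : ((Q.submatrix id g).submatrix p id).det = 0 :=
      Matrix.det_zero_of_row_eq hne (by funext c; simp [hab])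
    rw [this, mul_zero]
    exact Ideal.zero_mem _

/-- If `N = N G N` and the minors lie in every maximal ideal, they vanish. -/
lemma minorsIdeal_eq_bot [IsNoetherianRing B] (N : Matrix (Fin l) (Fin s) B)
    (G : Matrix (Fin s) (Fin l) B) (h : N * G * N = N) (k : ℕ)
    (hm : ∀ m : Ideal B, m.IsMaximal → minorsIdeal B l s N k ≤ m) :
    minorsIdeal B l s N k = ⊥ := by
  refine Submodule.eq_bot_of_le_smul_of_le_jacobson_bot (minorsIdeal B l s N k) _
    (IsNoetherian.noetherian _) ?_ ?_
  · have h1 : minorsIdeal B l s N k ≤ minorsIdeal B l l (N * G) k * minorsIdeal B l s N k := by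
      conv_lhs => rw [← h]
      exact minorsIdeal_mul _ _ _
    refine h1.trans ?_
    exact Ideal.mul_mono_left ((minorsIdeal_mul N G k).trans Ideal.mul_le_left)
  · refine le_sInf ?_
    rintro m ⟨_, hmm⟩
    exact hm m hmm

/-- The Schur complement identity. -/
lemma schur_identity (N : Matrix (Fin l) (Fin s) B) (k : ℕ)
    (h : minorsIdeal B l s N (k + 1) = ⊥) (f : Fin k → Fin l) (g : Fin k → Fin s) :
    (N.submatrix f g).det ^ 2 • N = N.submatrix id g *
      ((N.submatrix f g).det • (N.submatrix f g).adjugate) * N.submatrix f id := by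
  ext a b
  set D := N.submatrix f g with hD
  let u : Matrix (Fin k) (Fin 1) B := N.submatrix f (fun _ => b)
  let v : Matrix (Fin 1) (Fin k) B := N.submatrix (fun _ => a) g
  let w : Matrix (Fin 1) (Fin 1) B := N.submatrix (fun _ => a) (fun _ => b)
  have hdet : (Matrix.fromBlocks D u v w).det = 0 := by
    have hm := minor_mem N (Sum.elim f (fun _ : Fin 1 => a) ∘ finSumFinEquiv.symm)
      (Sum.elim g (fun _ : Fin 1 => b) ∘ finSumFinEquiv.symm)
    rw [h, Ideal.mem_bot, ← Matrix.submatrix_submatrix, Matrix.det_submatrix_equiv_self] at hm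
    rw [← hm]
    congr 1
    ext i j
    rcases i with i | i <;> rcases j with j | j <;> rfl
  have hmul : Matrix.fromBlocks D u v w *
      Matrix.fromBlocks 1 (-(D.adjugate * u)) 0 (D.det • (1 : Matrix (Fin 1) (Fin 1) B)) =
      Matrix.fromBlocks D 0 v (D.det • w - v * (D.adjugate * u)) := by
    rw [Matrix.fromBlocks_multiply]
    congr 1
    · simp
    · rw [Matrix.mul_neg, ← Matrix.mul_assoc, Matrix.mul_adjugate]
      simp
    · simp
    · simp [sub_eq_add_neg, add_comm]
  have h2 := congrArg Matrix.det hmul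
  rw [Matrix.det_mul, hdet, zero_mul, Matrix.det_fromBlocks_zero₁₂,
    Matrix.det_unique (D.det • w - v * (D.adjugate * u))] at h2
  have h3 : (v * (D.adjugate * u)) default default =
      (N.submatrix id g * D.adjugate * N.submatrix f id) a b := by
    rw [← Matrix.mul_assoc]
    simp [Matrix.mul_apply, u, v]
  have h4 : w default default = N a b := rfl
  rw [Matrix.sub_apply, Matrix.smul_apply, h3, h4] at h2
  rw [Matrix.mul_smul, Matrix.smul_mul, Matrix.smul_apply, Matrix.smul_apply]
  simp only [smul_eq_mul] at h2 ⊢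
  linear_combination -h2

lemma exists_ginv (N : Matrix (Fin l) (Fin s) B) (k : ℕ)
    (h : minorsIdeal B l s N (k + 1) = ⊥) (h' : minorsIdeal B l s N k = ⊤) :
    ∃ G : Matrix (Fin s) (Fin l) B, N * G * N = N := by
  let J : Ideal B :=
    { carrier := {x | ∃ G : Matrix (Fin s) (Fin l) B, N * G * N = x • N}
      add_mem' := by
        rintro x y ⟨G, hG⟩ ⟨G', hG'⟩
        exact ⟨G + G', by rw [Matrix.mul_add, Matrix.add_mul, hG, hG', add_smul]⟩
      zero_mem' := ⟨0, by simp⟩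
      smul_mem' := by
        rintro c x ⟨G, hG⟩
        exact ⟨c • G, by rw [Matrix.mul_smul, Matrix.smul_mul, hG, smul_smul, smul_eq_mul]⟩ }
  have hJ : (⊤ : Ideal B) ≤ J := by
    have h1 := Ideal.span_pow_eq_top _ h' 2
    rw [← h1]
    refine Ideal.span_le.2 ?_
    rintro x ⟨_, ⟨f, g, rfl⟩, rfl⟩
    have h2 := schur_identity N k h f g
    set D := N.submatrix f g with hD
    refine ⟨(1 : Matrix (Fin s) (Fin s) B).submatrix id g * (D.det • D.adjugate) *
      (1 : Matrix (Fin l) (Fin l) B).submatrix f id, ?_⟩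
    have e1 : N * (1 : Matrix (Fin s) (Fin s) B).submatrix id g = N.submatrix id g := by
      ext a b; simp [Matrix.mul_apply, Matrix.one_apply]
    have e2 : (1 : Matrix (Fin l) (Fin l) B).submatrix f id * N = N.submatrix f id := by
      ext a b; simp [Matrix.mul_apply, Matrix.one_apply]
    refine Eq.trans ?_ h2.symm
    rw [← e1, ← e2]
    simp only [Matrix.mul_assoc]
  obtain ⟨G, hG⟩ := hJ (Submodule.mem_top (x := (1 : B)))
  exact ⟨G, by rw [hG, one_smul]⟩

lemma projective_of_ginv (N : Matrix (Fin l) (Fin s) B)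
    (G : Matrix (Fin s) (Fin l) B) (h : N * G * N = N) :
    Module.Projective B ((Fin l → B) ⧸ LinearMap.range (Matrix.toLin' N)) := by
  have hle : LinearMap.range (Matrix.toLin' N) ≤
      LinearMap.ker (LinearMap.id - Matrix.toLin' (N * G)) := by
    rintro _ ⟨x, rfl⟩
    rw [LinearMap.mem_ker, LinearMap.sub_apply, LinearMap.id_apply, ← LinearMap.comp_apply,
      ← Matrix.toLin'_mul, h, sub_self]
  refine Module.Projective.of_split (Submodule.liftQ _ _ hle) (Submodule.mkQ _) ?_
  ext1
  ext1 x
  apply LinearMap.ext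
  intro c
  simp only [LinearMap.comp_apply, Submodule.mkQ_apply, Submodule.liftQ_apply, LinearMap.id_apply,
    LinearMap.sub_apply]
  rw [Submodule.Quotient.eq, sub_sub_cancel_left, Matrix.toLin'_mul]
  exact neg_mem ⟨_, rfl⟩

lemma exists_ginv_of_projective (N : Matrix (Fin l) (Fin s) B)
    (h : Module.Projective B ((Fin l → B) ⧸ LinearMap.range (Matrix.toLin' N))) :
    ∃ G : Matrix (Fin s) (Fin l) B, N * G * N = N := by
  obtain ⟨sec, hsec⟩ := LinearMap.exists_rightInverse_of_surjective
    (LinearMap.range (Matrix.toLin' N)).mkQ (Submodule.range_mkQ _)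
  have hs : ∀ x, (LinearMap.range (Matrix.toLin' N)).mkQ (sec x) = x := fun x =>
    LinearMap.congr_fun hsec x
  let p : (Fin l → B) →ₗ[B] (Fin l → B) :=
    LinearMap.id - sec ∘ₗ (LinearMap.range (Matrix.toLin' N)).mkQ
  have hp : ∀ x, p x ∈ LinearMap.range (Matrix.toLin' N) := by
    intro x
    rw [← Submodule.ker_mkQ (LinearMap.range (Matrix.toLin' N)), LinearMap.mem_ker]
    simp only [p, LinearMap.sub_apply, LinearMap.id_apply, LinearMap.comp_apply, map_sub, hs,
      sub_self]
  obtain ⟨γ, hγ⟩ := Module.projective_lifting_property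
    (Matrix.toLin' N).rangeRestrict (p.codRestrict _ hp) (LinearMap.surjective_rangeRestrict _)
  refine ⟨LinearMap.toMatrix' γ, ?_⟩
  apply Matrix.toLin'.injective
  rw [Matrix.toLin'_mul, Matrix.toLin'_mul, Matrix.toLin'_toMatrix']
  apply LinearMap.ext
  intro x
  have h1 := congrArg Subtype.val (LinearMap.congr_fun hγ (Matrix.toLin' N x))
  simp only [LinearMap.comp_apply] at h1 ⊢
  refine Eq.trans h1 ?_
  have h2 : (LinearMap.range (Matrix.toLin' N)).mkQ (Matrix.toLin' N x) = 0 := by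
    rw [← LinearMap.mem_ker, Submodule.ker_mkQ]; exact ⟨x, rfl⟩
  simp only [LinearMap.codRestrict_apply, p, LinearMap.sub_apply, LinearMap.id_apply,
    LinearMap.comp_apply, h2, map_zero, sub_zero]

lemma exists_rows {K : Type} [Field K] {m n : Type} [Fintype m] [Fintype n] (N : Matrix m n K)
    {k : ℕ} (hk : k ≤ N.rank) : ∃ f : Fin k → m, LinearIndependent K (N.submatrix f id).row := by
  rw [Matrix.rank_eq_finrank_span_row] at hk
  obtain ⟨v, hv, -, hli⟩ := Submodule.exists_fun_fin_finrank_span_eq K (Set.range N.row)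
  choose q hq using hv
  refine ⟨fun i => q (Fin.castLE hk i), ?_⟩
  have := hli.comp (Fin.castLE hk) (Fin.castLE_injective hk)
  have he : v ∘ Fin.castLE hk = (N.submatrix (fun i => q (Fin.castLE hk i)) id).row := by
    funext i
    exact (hq _).symm
  rw [he] at this
  exact this

lemma exists_minor {K : Type} [Field K] (N : Matrix (Fin l) (Fin s) K)
    {k : ℕ} (hk : k ≤ N.rank) :
    ∃ (f : Fin k → Fin l) (g : Fin k → Fin s), (N.submatrix f g).det ≠ 0 := by
  obtain ⟨f, hf⟩ := exists_rows N hk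
  have h1 := hf.rank_matrix
  rw [Fintype.card_fin, ← Matrix.rank_transpose] at h1
  obtain ⟨g, hg⟩ := exists_rows _ h1.ge
  refine ⟨f, g, ?_⟩
  rw [Matrix.linearIndependent_rows_iff_isUnit, Matrix.isUnit_iff_isUnit_det] at hg
  have := hg.ne_zero
  rwa [← Matrix.det_transpose] at this

lemma le_rank_of_minor {K : Type} [Field K] (N : Matrix (Fin l) (Fin s) K)
    {k : ℕ} (f : Fin k → Fin l) (g : Fin k → Fin s) (h : (N.submatrix f g).det ≠ 0) :
    k ≤ N.rank := by
  have := Matrix.rank_submatrix_le N f g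
  rwa [Matrix.rank_of_det_ne_zero h, Fintype.card_fin] at this

/-- Minors and the rank at a point. -/
lemma minorsIdeal_le_maximal_iff (N : Matrix (Fin l) (Fin s) B) (m : Ideal B) [m.IsMaximal]
    (k : ℕ) : minorsIdeal B l s N k ≤ m ↔ (N.map (Ideal.Quotient.mk m)).rank < k := by
  letI : Field (B ⧸ m) := Ideal.Quotient.field m
  have hd : ∀ (f : Fin k → Fin l) (g : Fin k → Fin s),
      ((N.map (Ideal.Quotient.mk m)).submatrix f g).det = 0 ↔ (N.submatrix f g).det ∈ m := by
    intro f g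
    rw [← Ideal.Quotient.eq_zero_iff_mem, RingHom.map_det]
    rfl
  rw [minorsIdeal_le_iff]
  constructor
  · intro h
    by_contra hc
    obtain ⟨f, g, hfg⟩ := exists_minor (K := B ⧸ m) (N.map (Ideal.Quotient.mk m)) (not_lt.1 hc)
    exact hfg ((hd f g).2 (h f g))
  · intro h f g
    rw [← hd]
    by_contra hc
    exact absurd (le_rank_of_minor (K := B ⧸ m) _ f g hc) (not_le.2 h)

lemma finrank_fibre (N : Matrix (Fin l) (Fin s) B) (m : Ideal B) [m.IsMaximal] :
    Module.finrank (B ⧸ m) ((B ⧸ m) ⊗[B] ((Fin l → B) ⧸ LinearMap.range (Matrix.toLin' N)))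
      + (N.map (Ideal.Quotient.mk m)).rank = l := by
  letI : Field (B ⧸ m) := Ideal.Quotient.field m
  let q := (LinearMap.range (Matrix.toLin' N)).mkQ
  have hq : Function.Surjective q := Submodule.mkQ_surjective _
  have hex : Function.Exact (Matrix.toLin' N) q := by
    rw [LinearMap.exact_iff]; exact Submodule.ker_mkQ _
  have hsurj : Function.Surjective (q.baseChange (B ⧸ m)) :=
    LinearMap.lTensor_surjective (B ⧸ m) hq
  have hex2 := lTensor_exact (B ⧸ m) hex hq
  have hker : LinearMap.ker (q.baseChange (B ⧸ m)) =
      LinearMap.range ((Matrix.toLin' N).baseChange (B ⧸ m)) := by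
    ext x
    exact hex2 x
  have h1 := LinearMap.finrank_range_add_finrank_ker (q.baseChange (B ⧸ m))
  rw [LinearMap.range_eq_top.2 hsurj, finrank_top, hker,
    Module.finrank_eq_card_basis ((Pi.basisFun B (Fin l)).baseChange (B ⧸ m)),
    Fintype.card_fin] at h1
  refine Eq.trans ?_ h1
  congr 1
  let b1 := Algebra.TensorProduct.basis (B ⧸ m) (Pi.basisFun B (Fin s))
  let b2 := Algebra.TensorProduct.basis (B ⧸ m) (Pi.basisFun B (Fin l))
  have h2 := LinearMap.toMatrix_baseChange (B ⧸ m) (Matrix.toLin' N) (Pi.basisFun B (Fin s))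
    (Pi.basisFun B (Fin l))
  rw [← Matrix.toLin_eq_toLin', LinearMap.toMatrix_toLin] at h2
  have h3 := Matrix.rank_eq_finrank_range_toLin (N.map (algebraMap B (B ⧸ m))) b2 b1
  rw [← h2, Matrix.toLin_toMatrix, h2, Matrix.toLin_eq_toLin'] at h3
  exact h3

end helpers

theorem fitting_strata_eq_flattening_strata
    (A : Type) [CommRing A] [IsNoetherianRing A]
    (l s : ℕ) (ρ : Matrix (Fin l) (Fin s) A)
    (j : ℕ) (hj : 1 ≤ j) (hjl : j ≤ l) :
    minorsIdeal A l s ρ (j + 1) ≤ minorsIdeal A l s ρ j ∧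
    (∀ (B : Type) [CommRing B] [IsNoetherianRing B] (φ : A →+* B),
      (Ideal.map φ (minorsIdeal A l s ρ (j + 1)) = ⊥ ∧
        Ideal.map φ (minorsIdeal A l s ρ j) = ⊤)
      ↔
      (Module.Finite B ((Fin l → B) ⧸ LinearMap.range (Matrix.toLin' (ρ.map φ))) ∧
       Module.Projective B ((Fin l → B) ⧸ LinearMap.range (Matrix.toLin' (ρ.map φ))) ∧
       ∀ (𝔪 : Ideal B), 𝔪.IsMaximal →
         Module.finrank (B ⧸ 𝔪)
           ((B ⧸ 𝔪) ⊗[B] ((Fin l → B) ⧸ LinearMap.range (Matrix.toLin' (ρ.map φ))))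
           = l - j)) := by
  refine ⟨minorsIdeal_succ_le ρ j, ?_⟩
  intro B _ _ φ
  rw [minorsIdeal_map, minorsIdeal_map]
  generalize ρ.map φ = N
  constructor
  · rintro ⟨h1, h2⟩
    obtain ⟨G, hG⟩ := exists_ginv N j h1 h2
    refine ⟨inferInstance, projective_of_ginv N G hG, ?_⟩
    intro m hm
    have h3 := finrank_fibre N m
    have h4 := (minorsIdeal_le_maximal_iff N m (j + 1)).1 (by rw [h1]; exact bot_le)
    have h5 : ¬ (N.map (Ideal.Quotient.mk m)).rank < j := by
      rw [← minorsIdeal_le_maximal_iff, h2, top_le_iff]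
      exact hm.ne_top
    omega
  · rintro ⟨-, hP, hr⟩
    obtain ⟨G, hG⟩ := exists_ginv_of_projective N hP
    have hrk : ∀ m : Ideal B, m.IsMaximal → (N.map (Ideal.Quotient.mk m)).rank = j := by
      intro m hm
      have h3 := finrank_fibre N m
      have h4 := hr m hm
      omega
    constructor
    · refine minorsIdeal_eq_bot N G hG _ fun m hm => ?_
      rw [minorsIdeal_le_maximal_iff, hrk m hm]
      exact Nat.lt_succ_self j
    · by_contra hne
      obtain ⟨m, hm, hle⟩ := Ideal.exists_le_maximal _ hne
      rw [minorsIdeal_le_maximal_iff, hrk m hm] at hle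
      exact lt_irrefl _ hle
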